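/- There exists a constant C > 0 such that x_c^n·G_n(θ) ≤ C·n^{−3/2} for all integers n ≥ 1 and all θ ∈ [0,π], where x_c := c₀·J₁(c₀)/(2π²). (Uniform-in-θ size bound, equation (eq:uniftheta) in the proof of Theorem 4.1 of the paper.) -/

import Mathlib

open MeasureTheory Real

noncomputable def J0 (x : ℝ) : ℝ :=
  ∑' k : ℕ, (-1 : ℝ) ^ k * (x / 2) ^ (2 * k) / ((Nat.factorial k : ℝ)) ^ 2

noncomputable def J1 (x : ℝ) : ℝ :=
  ∑' k : ℕ, (-1 : ℝ) ^ k * (x / 2) ^ (2 * k + 1) /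
    ((Nat.factorial k : ℝ) * (Nat.factorial (k + 1) : ℝ))

noncomputable def c0 : ℝ := sInf {x : ℝ | 0 < x ∧ J0 x = 0}

inductive BinTree : Type
  | leaf : BinTree
  | node : BinTree → BinTree → BinTree

def BinTree.leaves : BinTree → ℕ
  | .leaf => 1
  | .node l r => l.leaves + r.leaves

noncomputable def mAngle : BinTree → ℝ → ℝ
  | .leaf, _ => 1
  | .node l r, θ =>
      ∫ α in (0:ℝ)..Real.pi, ∫ β in (0:ℝ)..Real.pi,
        if θ < α + β ∧ α + β < Real.pi then mAngle l α * mAngle r β else 0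

noncomputable def G (n : ℕ) (θ : ℝ) : ℝ :=
  ∑' τ : {τ : BinTree // τ.leaves = n}, mAngle τ.1 θ

noncomputable def Sfun (y : ℝ) : ℝ := Real.sqrt y / Real.pi * J1 (2 * Real.pi * Real.sqrt y)

noncomputable def xc : ℝ := c0 * J1 c0 / (2 * Real.pi ^ 2)


open Polynomial Finset

/-- Evaluation at `t` of the Borel transform, i.e. the linear map `X ^ i ↦ t ^ i / i!`. -/
noncomputable def borelEval (t : ℝ) : ℝ[X] →ₗ[ℝ] ℝ :=
  Polynomial.lsum fun i => (t ^ i / (Nat.factorial i : ℝ)) • LinearMap.id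

lemma borelEval_monomial (t : ℝ) (i : ℕ) (a : ℝ) :
    borelEval t (monomial i a) = t ^ i / (Nat.factorial i : ℝ) * a := by
  simp [borelEval, Polynomial.lsum_apply, Polynomial.sum_monomial_index]

lemma borelEval_C_mul (t : ℝ) (a : ℝ) (P : ℝ[X]) :
    borelEval t (C a * P) = a * borelEval t P := by
  rw [← smul_eq_C_mul, map_smul, smul_eq_mul]

lemma borelEval_X_pow (t : ℝ) (i : ℕ) :
    borelEval t (X ^ i) = t ^ i / (Nat.factorial i : ℝ) := by
  rw [X_pow_eq_monomial, borelEval_monomial, mul_one]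

lemma borelEval_C (t a : ℝ) : borelEval t (C a) = a := by
  rw [← monomial_zero_left, borelEval_monomial]; simp

lemma borelEval_zero_X_pow_mul (k : ℕ) (hk : k ≠ 0) (P : ℝ[X]) :
    borelEval 0 (X ^ k * P) = 0 := by
  induction P using Polynomial.induction_on' with
  | add p q hp hq => rw [mul_add, map_add, hp, hq, add_zero]
  | monomial i a =>
    rw [X_pow_eq_monomial, monomial_mul_monomial, borelEval_monomial]
    simp [hk]

lemma continuous_borelEval (P : ℝ[X]) : Continuous fun t => borelEval t P := by
  induction P using Polynomial.induction_on' with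
  | add p q hp hq => simp only [map_add]; exact hp.add hq
  | monomial i a => simp only [borelEval_monomial]; fun_prop

lemma integral_borelEval (P : ℝ[X]) (t : ℝ) :
    ∫ x in (0:ℝ)..t, borelEval x P = borelEval t (X * P) := by
  induction P using Polynomial.induction_on' with
  | add p q hp hq =>
    simp only [map_add, mul_add]
    rw [intervalIntegral.integral_add ((continuous_borelEval p).intervalIntegrable _ _)
      ((continuous_borelEval q).intervalIntegrable _ _), hp, hq]
  | monomial i a =>
    rw [X_mul_monomial]
    simp only [borelEval_monomial]
    rw [intervalIntegral.integral_mul_const, intervalIntegral.integral_div, integral_pow,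
      Nat.factorial_succ]
    have : (Nat.factorial i : ℝ) ≠ 0 := by positivity
    push_cast
    field_simp
    simp

lemma integral_pow_mul_sub_pow (t : ℝ) (i : ℕ) : ∀ j : ℕ,
    ∫ x in (0:ℝ)..t, x ^ i / (Nat.factorial i : ℝ) * ((t - x) ^ j / (Nat.factorial j : ℝ)) =
      t ^ (i + j + 1) / (Nat.factorial (i + j + 1) : ℝ) := by
  induction i with
  | zero =>
    intro j
    have h := intervalIntegral.integral_comp_sub_left
      (fun y : ℝ => y ^ j / (Nat.factorial j : ℝ)) (a := 0) (b := t) t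
    simp only [pow_zero, Nat.factorial_zero, Nat.cast_one, div_one, one_mul, zero_add]
    rw [h, sub_self, sub_zero, intervalIntegral.integral_div, integral_pow, Nat.factorial_succ]
    have : (Nat.factorial j : ℝ) ≠ 0 := by positivity
    push_cast
    field_simp
    simp
  | succ i ih =>
    intro j
    have hd : ∀ x ∈ Set.uIcc 0 t, HasDerivAt (fun x : ℝ => x ^ (i + 1) / (Nat.factorial (i + 1) : ℝ) *
        ((t - x) ^ (j + 1) / (Nat.factorial (j + 1) : ℝ)))
        (x ^ i / (Nat.factorial i : ℝ) * ((t - x) ^ (j + 1) / (Nat.factorial (j + 1) : ℝ)) -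
        x ^ (i + 1) / (Nat.factorial (i + 1) : ℝ) * ((t - x) ^ j / (Nat.factorial j : ℝ))) x := by
      intro x _
      have h1 := ((hasDerivAt_id x).pow (i + 1)).div_const (Nat.factorial (i + 1) : ℝ)
      have h2 := (((hasDerivAt_id x).const_sub t).pow (j + 1)).div_const (Nat.factorial (j + 1) : ℝ)
      refine (h1.mul h2).congr_deriv ?_
      have : (Nat.factorial j : ℝ) ≠ 0 := by positivity
      have : (Nat.factorial i : ℝ) ≠ 0 := by positivity
      simp only [Nat.factorial_succ, Pi.pow_apply, id, Nat.add_sub_cancel]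
      push_cast
      field_simp
      ring
    have h := intervalIntegral.integral_eq_sub_of_hasDerivAt hd
      (Continuous.intervalIntegrable (by fun_prop) _ _)
    rw [intervalIntegral.integral_sub (Continuous.intervalIntegrable (by fun_prop) _ _)
      (Continuous.intervalIntegrable (by fun_prop) _ _), ih (j + 1)] at h
    simp at h
    have e : i + 1 + j + 1 = i + (j + 1) + 1 := by ring
    rw [e]
    linarith

lemma integral_borelEval_mul_sub (P Q : ℝ[X]) (t : ℝ) :
    ∫ x in (0:ℝ)..t, borelEval x P * borelEval (t - x) Q = borelEval t (X * P * Q) := by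
  have hc : ∀ P Q : ℝ[X], Continuous fun x => borelEval x P * borelEval (t - x) Q := fun P Q =>
    (continuous_borelEval P).mul ((continuous_borelEval Q).comp (by fun_prop))
  induction P using Polynomial.induction_on' with
  | add p q hp hq =>
    simp only [map_add, mul_add, add_mul]
    rw [intervalIntegral.integral_add ((hc p Q).intervalIntegrable _ _)
      ((hc q Q).intervalIntegrable _ _), hp, hq]
  | monomial i a =>
    induction Q using Polynomial.induction_on' with
    | add p q hp hq =>
      simp only [map_add, mul_add]
      rw [intervalIntegral.integral_add ((hc _ p).intervalIntegrable _ _)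
        ((hc _ q).intervalIntegrable _ _), hp, hq]
    | monomial j b =>
      rw [X_mul_monomial, monomial_mul_monomial]
      simp only [borelEval_monomial]
      have e : ∀ x : ℝ, x ^ i / (Nat.factorial i : ℝ) * a * ((t - x) ^ j / (Nat.factorial j : ℝ) * b)
        = x ^ i / (Nat.factorial i : ℝ) * ((t - x) ^ j / (Nat.factorial j : ℝ)) * (a * b) := by
        intro x; ring
      simp only [e]
      rw [intervalIntegral.integral_mul_const, integral_pow_mul_sub_pow]
      congr 2
      ring_nf
      ring_nf

lemma integral_indicator_angle (g : ℝ → ℝ) (hg : Continuous g) {θ α : ℝ} (hθ : θ ≤ π)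
    (hα : 0 ≤ α) (hα' : α ≤ π) :
    ∫ β in (0:ℝ)..π, (if θ < α + β ∧ α + β < π then g β else 0) =
      (∫ β in (0:ℝ)..(π - α), g β) - ∫ β in (0:ℝ)..(max 0 (θ - α)), g β := by
  have hm : max 0 (θ - α) ≤ π - α := max_le (by linarith) (by linarith)
  rw [intervalIntegral.integral_interval_sub_left (hg.intervalIntegrable _ _)
    (hg.intervalIntegrable _ _), intervalIntegral.integral_of_le pi_pos.le,
    intervalIntegral.integral_of_le hm, integral_Ioc_eq_integral_Ioo' (x := max 0 (θ - α)) (by simp)]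
  rw [← integral_indicator measurableSet_Ioc, ← integral_indicator measurableSet_Ioo]
  congr 1
  ext β
  simp only [Set.indicator, Set.mem_Ioc, Set.mem_Ioo, max_lt_iff]
  by_cases h : θ < α + β ∧ α + β < π <;> by_cases h' : 0 < β
  · have : β ≤ π := by linarith
    have h1 : θ - α < β := by linarith
    have h2 : β < π - α := by linarith
    simp [h, h', this, h1, h2]
  · simp [h']
  · have : ¬ ((0 < β ∧ θ - α < β) ∧ β < π - α) := fun hh =>
      h ⟨by linarith [hh.1.2], by linarith [hh.2]⟩
    simp [h, this]
  · simp [h']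

lemma integral_angle_borelEval (P Q : ℝ[X]) {θ : ℝ} (h0 : 0 ≤ θ) (hθ : θ ≤ π) :
    ∫ α in (0:ℝ)..π, ∫ β in (0:ℝ)..π,
      (if θ < α + β ∧ α + β < π then borelEval α P * borelEval β Q else 0) =
      borelEval π (X ^ 2 * (P * Q)) - borelEval θ (X ^ 2 * (P * Q)) := by
  have key : ∀ t, ∫ α in (0:ℝ)..t, borelEval α P * ∫ β in (0:ℝ)..(t - α), borelEval β Q =
      borelEval t (X ^ 2 * (P * Q)) := by
    intro t
    simp only [integral_borelEval]
    rw [integral_borelEval_mul_sub]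
    congr 1
    ring
  have hF : Continuous fun t => ∫ β in (0:ℝ)..t, borelEval β Q := by
    simp only [integral_borelEval]
    exact continuous_borelEval _
  have h1 : ∫ α in (0:ℝ)..π, ∫ β in (0:ℝ)..π,
      (if θ < α + β ∧ α + β < π then borelEval α P * borelEval β Q else 0) =
      ∫ α in (0:ℝ)..π, (borelEval α P * (∫ β in (0:ℝ)..(π - α), borelEval β Q) -
        borelEval α P * ∫ β in (0:ℝ)..(max 0 (θ - α)), borelEval β Q) := by
    apply intervalIntegral.integral_congr
    intro α hα
    rw [Set.uIcc_of_le pi_pos.le] at hα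
    simp only
    rw [integral_indicator_angle (fun β => borelEval α P * borelEval β Q)
      (continuous_const.mul (continuous_borelEval Q)) hθ hα.1 hα.2]
    simp only [intervalIntegral.integral_const_mul]
  have hc1 : Continuous fun α => borelEval α P * (∫ β in (0:ℝ)..(π - α), borelEval β Q) :=
    (continuous_borelEval P).mul (hF.comp (by fun_prop))
  have hc2 : Continuous fun α => borelEval α P * (∫ β in (0:ℝ)..(max 0 (θ - α)), borelEval β Q) :=
    (continuous_borelEval P).mul (hF.comp (by fun_prop))
  rw [h1, intervalIntegral.integral_sub (hc1.intervalIntegrable _ _)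
    (hc2.intervalIntegrable _ _), key, ← key θ]
  congr 1
  rw [← intervalIntegral.integral_add_adjacent_intervals (hc2.intervalIntegrable 0 θ)
    (hc2.intervalIntegrable θ π)]
  have h2 : ∫ α in θ..π, borelEval α P * (∫ β in (0:ℝ)..(max 0 (θ - α)), borelEval β Q) = 0 := by
    refine (intervalIntegral.integral_congr fun α hα => ?_).trans intervalIntegral.integral_zero
    rw [Set.uIcc_of_le hθ] at hα
    rw [max_eq_left (by linarith [hα.1]), intervalIntegral.integral_same, mul_zero]
  rw [h2, add_zero]
  apply intervalIntegral.integral_congr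
  intro α hα
  rw [Set.uIcc_of_le h0] at hα
  simp only
  rw [max_eq_right (by linarith [hα.2])]

/-- The Borel transform of the angle function of a tree. -/
noncomputable def anglePoly : BinTree → ℝ[X]
  | .leaf => 1
  | .node l r => C (borelEval π (X ^ 2 * (anglePoly l * anglePoly r))) -
      X ^ 2 * (anglePoly l * anglePoly r)

lemma mAngle_eq_borelEval (τ : BinTree) {θ : ℝ} (h0 : 0 ≤ θ) (hθ : θ ≤ π) :
    mAngle τ θ = borelEval θ (anglePoly τ) := by
  induction τ generalizing θ with
  | leaf =>
    rw [mAngle, anglePoly, ← C_1, borelEval_C]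
  | node l r hl hr =>
    rw [mAngle, anglePoly, map_sub, borelEval_C, ← integral_angle_borelEval _ _ h0 hθ]
    apply intervalIntegral.integral_congr
    intro α hα
    apply intervalIntegral.integral_congr
    intro β hβ
    rw [Set.uIcc_of_le pi_pos.le] at hα hβ
    simp only
    rw [hl hα.1 hα.2, hr hβ.1 hβ.2]

lemma mAngle_nonneg (τ : BinTree) (θ : ℝ) : 0 ≤ mAngle τ θ := by
  induction τ generalizing θ with
  | leaf => rw [mAngle]; exact zero_le_one
  | node l r hl hr =>
    rw [mAngle]
    refine intervalIntegral.integral_nonneg pi_pos.le fun α _ =>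
      intervalIntegral.integral_nonneg pi_pos.le fun β _ => ?_
    split_ifs
    · exact mul_nonneg (hl _) (hr _)
    · exact le_rfl

lemma mAngle_le_mAngle_zero (τ : BinTree) {θ : ℝ} (h0 : 0 ≤ θ) (hθ : θ ≤ π) :
    mAngle τ θ ≤ mAngle τ 0 := by
  cases τ with
  | leaf => simp [mAngle]
  | node l r =>
    rw [mAngle_eq_borelEval _ h0 hθ, mAngle_eq_borelEval _ le_rfl pi_pos.le, anglePoly, map_sub,
      map_sub, borelEval_C, borelEval_C, borelEval_zero_X_pow_mul 2 two_ne_zero]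
    have : 0 ≤ borelEval θ (X ^ 2 * (anglePoly l * anglePoly r)) := by
      have h := integral_borelEval_mul_sub (anglePoly l) (X * anglePoly r) θ
      have e : X * anglePoly l * (X * anglePoly r) = X ^ 2 * (anglePoly l * anglePoly r) := by ring
      rw [e] at h
      rw [← h]
      refine intervalIntegral.integral_nonneg h0 fun α hα => mul_nonneg ?_ ?_
      · rw [← mAngle_eq_borelEval _ hα.1 (hα.2.trans hθ)]
        exact mAngle_nonneg _ _
      · rw [← integral_borelEval]
        refine intervalIntegral.integral_nonneg (by linarith [hα.2]) fun β hβ => ?_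
        rw [← mAngle_eq_borelEval _ hβ.1 (by linarith [hβ.2, hα.1])]
        exact mAngle_nonneg _ _
    linarith

lemma BinTree.leaves_pos (τ : BinTree) : 0 < τ.leaves := by
  induction τ with
  | leaf => simp [BinTree.leaves]
  | node l r hl hr => rw [BinTree.leaves]; omega

/-- Splitting a tree with at least two leaves into its two subtrees. -/
def nodeEquiv (n : ℕ) (hn : n ≠ 1) : {τ : BinTree // τ.leaves = n} ≃
    Σ p : antidiagonal n, {τ : BinTree // τ.leaves = p.1.1} × {τ : BinTree // τ.leaves = p.1.2} where
  toFun := fun τ => match τ with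
    | ⟨.leaf, h⟩ => absurd h.symm hn
    | ⟨.node l r, h⟩ =>
      ⟨⟨(l.leaves, r.leaves), by simpa [BinTree.leaves] using h⟩, ⟨l, rfl⟩, ⟨r, rfl⟩⟩
  invFun := fun s => ⟨.node s.2.1.1 s.2.2.1, by
    rw [BinTree.leaves, s.2.1.2, s.2.2.2]; exact HasAntidiagonal.mem_antidiagonal.1 s.1.2⟩
  left_inv := by
    rintro ⟨τ, h⟩
    cases τ with
    | leaf => exact absurd h.symm hn
    | node l r => rfl
  right_inv := by
    rintro ⟨⟨⟨i, j⟩, hp⟩, ⟨l, hl⟩, ⟨r, hr⟩⟩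
    simp only at hl hr
    subst hl hr
    rfl

lemma isEmpty_leaves_zero : IsEmpty {τ : BinTree // τ.leaves = 0} :=
  ⟨fun τ => τ.1.leaves_pos.ne' τ.2⟩

lemma eq_leaf_of_leaves_eq_one {τ : BinTree} (h : τ.leaves = 1) : τ = .leaf := by
  cases τ with
  | leaf => rfl
  | node l r =>
    rw [BinTree.leaves] at h
    have := l.leaves_pos
    have := r.leaves_pos
    omega

instance finite_leaves (n : ℕ) : Finite {τ : BinTree // τ.leaves = n} := by
  induction n using Nat.strong_induction_on with
  | _ n ih =>
    rcases eq_or_ne n 1 with rfl | hn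
    · have : Subsingleton {τ : BinTree // τ.leaves = 1} := ⟨fun a b => Subtype.ext <|
        (eq_leaf_of_leaves_eq_one a.2).trans (eq_leaf_of_leaves_eq_one b.2).symm⟩
      infer_instance
    · rcases eq_or_ne n 0 with rfl | h0
      · have := isEmpty_leaves_zero
        infer_instance
      have : ∀ p : antidiagonal n,
          Finite ({τ : BinTree // τ.leaves = p.1.1} × {τ : BinTree // τ.leaves = p.1.2}) := by
        rintro ⟨⟨i, j⟩, hp⟩
        rw [HasAntidiagonal.mem_antidiagonal] at hp
        simp only at hp ⊢
        rcases eq_or_ne i 0 with rfl | hi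
        · have := isEmpty_leaves_zero
          infer_instance
        rcases eq_or_ne j 0 with rfl | hj
        · have := isEmpty_leaves_zero
          infer_instance
        have := ih i (by omega)
        have := ih j (by omega)
        infer_instance
      exact Finite.of_equiv _ (nodeEquiv n hn).symm

noncomputable instance fintypeLeaves (n : ℕ) : Fintype {τ : BinTree // τ.leaves = n} :=
  Fintype.ofFinite _

/-- The Borel transform of `G n`. -/
noncomputable def gPoly (n : ℕ) : ℝ[X] := ∑ τ : {τ : BinTree // τ.leaves = n}, anglePoly τ.1

lemma G_eq_borelEval (n : ℕ) {θ : ℝ} (h0 : 0 ≤ θ) (hθ : θ ≤ π) :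
    G n θ = borelEval θ (gPoly n) := by
  rw [G, tsum_fintype, gPoly, map_sum]
  exact Finset.sum_congr rfl fun τ _ => mAngle_eq_borelEval _ h0 hθ

lemma G_nonneg (n : ℕ) (θ : ℝ) : 0 ≤ G n θ := tsum_nonneg fun _ => mAngle_nonneg _ _

lemma G_le_G_zero (n : ℕ) {θ : ℝ} (h0 : 0 ≤ θ) (hθ : θ ≤ π) : G n θ ≤ G n 0 := by
  rw [G, tsum_fintype, G, tsum_fintype]
  exact Finset.sum_le_sum fun τ _ => mAngle_le_mAngle_zero _ h0 hθ

lemma gPoly_zero : gPoly 0 = 0 := by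
  have := isEmpty_leaves_zero
  simp [gPoly]

lemma gPoly_one : gPoly 1 = 1 := by
  rw [gPoly, Fintype.sum_eq_single (⟨.leaf, rfl⟩ : {τ : BinTree // τ.leaves = 1})]
  · rfl
  · intro τ h
    exact absurd (Subtype.ext (eq_leaf_of_leaves_eq_one τ.2)) h

lemma gPoly_of_ne_one {n : ℕ} (hn : n ≠ 1) :
    gPoly n = C (borelEval π (X ^ 2 * ∑ p ∈ antidiagonal n, gPoly p.1 * gPoly p.2)) -
      X ^ 2 * ∑ p ∈ antidiagonal n, gPoly p.1 * gPoly p.2 := by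
  have h : ∑ p ∈ antidiagonal n, gPoly p.1 * gPoly p.2 = ∑ s : (Σ p : antidiagonal n,
      {τ : BinTree // τ.leaves = p.1.1} × {τ : BinTree // τ.leaves = p.1.2}),
      anglePoly s.2.1.1 * anglePoly s.2.2.1 := by
    rw [Fintype.sum_sigma, ← Finset.sum_coe_sort]
    refine Finset.sum_congr rfl fun p _ => ?_
    rw [Fintype.sum_prod_type, gPoly, gPoly, Finset.sum_mul_sum]
  rw [h, Finset.mul_sum, map_sum, map_sum, ← Finset.sum_sub_distrib, gPoly]
  exact Fintype.sum_equiv (nodeEquiv n hn) _ _ fun τ => by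
    obtain ⟨τ, hτ⟩ := τ
    cases τ with
    | leaf => exact absurd hτ.symm hn
    | node l r => rfl

lemma gPoly_eq (n : ℕ) : gPoly n = (if n = 1 then 1 else 0) +
    (C (borelEval π (X ^ 2 * ∑ p ∈ antidiagonal n, gPoly p.1 * gPoly p.2)) -
      X ^ 2 * ∑ p ∈ antidiagonal n, gPoly p.1 * gPoly p.2) := by
  split_ifs with h
  · subst h
    simp [Finset.Nat.antidiagonal_succ, gPoly_zero, gPoly_one]
  · rw [zero_add]
    exact gPoly_of_ne_one h

/-- The coefficients of `S(y)/y`, where `S(y) = √y / π * J₁(2π√y)`. -/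
noncomputable def besselCoeff (j : ℕ) : ℝ :=
  (-1) ^ j * π ^ (2 * j) / ((Nat.factorial j : ℝ) * (Nat.factorial (j + 1) : ℝ))

/-- The partial sums of the power series of `S(y)/y`. -/
noncomputable def besselPoly (N : ℕ) : ℝ[X] := ∑ j ∈ range (N + 1), C (besselCoeff j) * X ^ j

lemma coeff_besselPoly {N j : ℕ} (h : j ≤ N) : (besselPoly N).coeff j = besselCoeff j := by
  simp only [besselPoly, finsetSum_coeff, coeff_C_mul_X_pow]
  rw [Finset.sum_ite_eq, if_pos (by simpa using Nat.lt_succ_of_le h)]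

lemma catalan_div_factorial (j : ℕ) : (catalan j : ℝ) / (Nat.factorial (2 * j) : ℝ) =
    1 / ((Nat.factorial j : ℝ) * (Nat.factorial (j + 1) : ℝ)) := by
  have h1 : ((j + 1 : ℕ) : ℝ) * catalan j = j.centralBinom := by
    exact_mod_cast succ_mul_catalan_eq_centralBinom j
  have h2 : (j.centralBinom : ℝ) * (Nat.factorial j) * (Nat.factorial j) = Nat.factorial (2 * j) := by
    have := Nat.choose_mul_factorial_mul_factorial (n := 2 * j) (k := j) (by omega)
    rw [show 2 * j - j = j by omega] at this
    rw [Nat.centralBinom]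
    exact_mod_cast this
  have h3 : (Nat.factorial j : ℝ) ≠ 0 := by positivity
  have h4 : (Nat.factorial (2 * j) : ℝ) ≠ 0 := by positivity
  have h5 : ((j + 1 : ℕ) : ℝ) ≠ 0 := by positivity
  rw [Nat.factorial_succ, div_eq_div_iff h4 (by positivity), ← h2, ← h1]
  push_cast
  ring

/-- The composition of the generating polynomial `∑ k ≤ n, gPoly k * Y ^ k` with a polynomial. -/
noncomputable def gComp (n : ℕ) (S : ℝ[X]) (U : ℕ → ℝ[X]) : ℝ[X][X] :=
  ∑ k ∈ range (n + 1), C (U k) * (S.map C) ^ k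

lemma coeff_gComp (n : ℕ) (S : ℝ[X]) (U : ℕ → ℝ[X]) (m : ℕ) :
    (gComp n S U).coeff m = ∑ k ∈ range (n + 1), C ((S ^ k).coeff m) * U k := by
  simp only [gComp, finsetSum_coeff, coeff_C_mul, ← Polynomial.map_pow, coeff_map]
  exact Finset.sum_congr rfl fun k _ => mul_comm _ _

lemma coeff_X_mul_pow_of_lt {R : Type*} [CommRing R] (F : R[X]) {k m : ℕ} (h : m < k) :
    ((X * F) ^ k).coeff m = 0 := by
  rw [mul_pow, coeff_X_pow_mul', if_neg (by omega)]

lemma coeff_gComp_sq (n : ℕ) (F : ℝ[X]) (U : ℕ → ℝ[X]) {m : ℕ} (hm : m ≤ n) :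
    (gComp n (X * F) fun k => ∑ p ∈ antidiagonal k, U p.1 * U p.2).coeff m =
      ∑ p ∈ antidiagonal m, (gComp n (X * F) U).coeff p.1 * (gComp n (X * F) U).coeff p.2 := by
  rw [← coeff_mul]
  have h1 : gComp n (X * F) U * gComp n (X * F) U = ∑ p ∈ range (n + 1) ×ˢ range (n + 1),
      C (U p.1 * U p.2) * ((X * F).map C) ^ (p.1 + p.2) := by
    rw [gComp, Finset.sum_mul_sum, Finset.sum_product]
    refine Finset.sum_congr rfl fun i _ => Finset.sum_congr rfl fun j _ => ?_
    rw [C_mul, pow_add]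
    ring
  have h2 : (gComp n (X * F) fun k => ∑ p ∈ antidiagonal k, U p.1 * U p.2) =
      ∑ p ∈ (range (n + 1) ×ˢ range (n + 1)).filter (fun p => p.1 + p.2 ∈ range (n + 1)),
        C (U p.1 * U p.2) * ((X * F).map C) ^ (p.1 + p.2) := by
    rw [gComp, ← Finset.sum_fiberwise_of_maps_to (g := fun p : ℕ × ℕ => p.1 + p.2)
      (t := range (n + 1)) (fun p hp => (Finset.mem_filter.1 hp).2)]
    refine Finset.sum_congr rfl fun k hk => ?_
    rw [map_sum, Finset.sum_mul]
    rw [Finset.mem_range] at hk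
    refine Finset.sum_congr ?_ ?_
    · ext p
      simp only [HasAntidiagonal.mem_antidiagonal, Finset.mem_filter, Finset.mem_product,
        Finset.mem_range]
      omega
    · intro p hp
      rw [(Finset.mem_filter.1 hp).2]
  rw [h1, h2, ← Finset.sum_filter_add_sum_filter_not (range (n + 1) ×ˢ range (n + 1))
    (fun p => p.1 + p.2 ∈ range (n + 1)), coeff_add, left_eq_add, finsetSum_coeff]
  refine Finset.sum_eq_zero fun p hp => ?_
  have hp' := (Finset.mem_filter.1 hp).2
  rw [Finset.mem_range] at hp'
  rw [coeff_C_mul, ← Polynomial.map_pow, coeff_map, coeff_X_mul_pow_of_lt F (by omega), map_zero,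
    mul_zero]

lemma coeff_gComp_gPoly (n : ℕ) (hn : 1 ≤ n) (F : ℝ[X]) {m : ℕ} (hm : m ≤ n) :
    (gComp n (X * F) gPoly).coeff m = C ((X * F).coeff m) +
      (C (borelEval π (X ^ 2 * ∑ p ∈ antidiagonal m,
        (gComp n (X * F) gPoly).coeff p.1 * (gComp n (X * F) gPoly).coeff p.2)) -
      X ^ 2 * ∑ p ∈ antidiagonal m,
        (gComp n (X * F) gPoly).coeff p.1 * (gComp n (X * F) gPoly).coeff p.2) := by
  rw [← coeff_gComp_sq n F gPoly hm, coeff_gComp, coeff_gComp]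
  conv_lhs => enter [2, k]; rw [gPoly_eq k]
  simp only [mul_add, Finset.sum_add_distrib, mul_sub, Finset.sum_sub_distrib]
  congr 1
  · rw [Finset.sum_eq_single 1]
    · simp
    · intro k _ hk
      simp [hk]
    · intro h
      simp at h
      omega
  · congr 1
    · rw [Finset.mul_sum, map_sum, map_sum]
      refine Finset.sum_congr rfl fun k _ => ?_
      rw [mul_left_comm, borelEval_C_mul, C_mul]
    · rw [Finset.mul_sum]
      exact Finset.sum_congr rfl fun k _ => mul_left_comm _ _ _

lemma coeff_gComp_besselPoly (n : ℕ) (hn : 1 ≤ n) {N : ℕ} (hN : n ≤ N) (m : ℕ) :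
    m + 1 ≤ n → (gComp n (X * besselPoly N) gPoly).coeff (m + 1) =
      C ((-1) ^ m * (catalan m : ℝ)) * X ^ (2 * m) := by
  have h0 : (gComp n (X * besselPoly N) gPoly).coeff 0 = 0 := by
    rw [coeff_gComp]
    refine Finset.sum_eq_zero fun k _ => ?_
    rcases Nat.eq_zero_or_pos k with rfl | hk
    · rw [gPoly_zero, mul_zero]
    · rw [coeff_X_mul_pow_of_lt _ hk, map_zero, zero_mul]
  induction m using Nat.strong_induction_on with
  | _ m ih =>
    intro hm
    rw [coeff_gComp_gPoly n hn _ hm, coeff_X_mul, coeff_besselPoly (by omega), besselCoeff]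
    cases m with
    | zero => simp [Finset.Nat.antidiagonal_succ, h0]
    | succ k =>
      have hV : ∑ p ∈ antidiagonal (k + 1 + 1), (gComp n (X * besselPoly N) gPoly).coeff p.1 *
          (gComp n (X * besselPoly N) gPoly).coeff p.2 =
          C ((-1) ^ k * (catalan (k + 1) : ℝ)) * X ^ (2 * k) := by
        rw [Finset.Nat.antidiagonal_succ_succ', Finset.sum_cons, Finset.sum_cons, Finset.sum_map]
        simp only [h0, zero_mul, mul_zero, zero_add]
        rw [catalan_succ', Nat.cast_sum, Finset.mul_sum, map_sum, Finset.sum_mul]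
        refine Finset.sum_congr rfl fun p hp => ?_
        rw [HasAntidiagonal.mem_antidiagonal] at hp
        change (gComp n (X * besselPoly N) gPoly).coeff (p.1 + 1) *
          (gComp n (X * besselPoly N) gPoly).coeff (p.2 + 1) = _
        rw [ih p.1 (by omega) (by omega),
          ih p.2 (by omega) (by omega), ← hp]
        simp only [C_mul, Nat.cast_mul, pow_add, mul_add]
        ring
      rw [hV, mul_left_comm, ← pow_add, borelEval_C_mul, borelEval_X_pow, ← add_sub_assoc, ← C_add]
      have e : (-1) ^ (k + 1) * π ^ (2 * (k + 1)) /
          ((Nat.factorial (k + 1) : ℝ) * (Nat.factorial (k + 1 + 1) : ℝ)) +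
          (-1) ^ k * (catalan (k + 1) : ℝ) * (π ^ (2 + 2 * k) / (Nat.factorial (2 + 2 * k) : ℝ)) = 0 := by
        have h := catalan_div_factorial (k + 1)
        rw [show 2 + 2 * k = 2 * (k + 1) by ring]
        rw [div_eq_mul_one_div, ← h]
        ring
      rw [e, C_0, zero_sub, ← neg_mul, ← C_neg]
      congr 2
      · ring
      · ring

/-- The generating function of `G k 0` inverts `S` up to order `n`. -/
lemma X_pow_dvd_X_sub_sum_G {n : ℕ} (hn : 1 ≤ n) {N : ℕ} (hN : n ≤ N) :
    (X : ℝ[X]) ^ (n + 1) ∣ X - ∑ k ∈ range (n + 1), C (G k 0) * (X * besselPoly N) ^ k := by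
  rw [X_pow_dvd_iff]
  intro m hm
  have h : ∀ m, (∑ k ∈ range (n + 1), C (G k 0) * (X * besselPoly N) ^ k).coeff m =
      borelEval 0 ((gComp n (X * besselPoly N) gPoly).coeff m) := by
    intro m
    rw [coeff_gComp, finsetSum_coeff, map_sum]
    refine Finset.sum_congr rfl fun k _ => ?_
    rw [coeff_C_mul, borelEval_C_mul, G_eq_borelEval k le_rfl pi_pos.le, mul_comm]
  rw [coeff_sub, h]
  cases m with
  | zero =>
    rw [coeff_gComp, map_sum, Finset.sum_eq_zero]
    · simp
    intro k _
    rcases Nat.eq_zero_or_pos k with rfl | hk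
    · rw [gPoly_zero, mul_zero, map_zero]
    · rw [coeff_X_mul_pow_of_lt _ hk, map_zero, zero_mul, map_zero]
  | succ m =>
    rw [coeff_gComp_besselPoly n hn hN m (by omega), borelEval_C_mul, borelEval_X_pow]
    cases m with
    | zero => simp
    | succ k => simp [coeff_X]

lemma circleIntegral_pow_mul_deriv_div_pow {f : ℂ → ℂ} {f' : ℂ → ℂ} {r : ℝ} (hr : 0 ≤ r)
    (hf : ∀ z, HasDerivAt f (f' z) z) (h0 : ∀ z ∈ Metric.sphere (0 : ℂ) r, f z ≠ 0) {k : ℤ}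
    (hk : k ≠ -1) : (∮ z in C(0, r), f z ^ k * f' z) = 0 := by
  refine circleIntegral.integral_eq_zero_of_hasDerivWithinAt
    (f := fun z => f z ^ (k + 1) / ((k + 1 : ℤ) : ℂ)) hr fun z hz => HasDerivAt.hasDerivWithinAt ?_
  have hk' : ((k + 1 : ℤ) : ℂ) ≠ 0 := by
    rw [Int.cast_ne_zero]
    omega
  refine (((hasDerivAt_zpow (k + 1) (f z) (Or.inl (h0 z hz))).comp z (hf z)).div_const
    ((k + 1 : ℤ) : ℂ)).congr_deriv ?_
  rw [add_sub_cancel_right]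
  field_simp

lemma circleIntegral_logDeriv_X_mul (F : ℂ[X]) {r : ℝ} (hr : 0 < r)
    (hF : ∀ z ∈ Metric.closedBall (0 : ℂ) r, F.eval z ≠ 0) :
    (∮ z in C(0, r), ((X * F).eval z)⁻¹ * (derivative (X * F)).eval z) = 2 * π * Complex.I := by
  have hsub := Metric.sphere_subset_closedBall (x := (0 : ℂ)) (ε := r)
  have h1 : (∮ z in C(0, r), ((X * F).eval z)⁻¹ * (derivative (X * F)).eval z) =
      ∮ z in C(0, r), ((z - 0)⁻¹ + (derivative F).eval z / F.eval z) := by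
    refine circleIntegral.integral_congr hr.le fun z hz => ?_
    have hz0 : z ≠ 0 := by
      rintro rfl
      simp at hz
      exact hr.ne hz
    have := hF z (hsub hz)
    simp only [derivative_mul, derivative_X, eval_add, eval_mul, eval_X, one_mul, sub_zero]
    field_simp
  have hc : ContinuousOn (fun z => (derivative F).eval z / F.eval z) (Metric.closedBall 0 r) :=
    (derivative F).continuous.continuousOn.div F.continuous.continuousOn hF
  rw [h1, circleIntegral.integral_add, circleIntegral.integral_sub_center_inv 0 hr.ne',
    Complex.circleIntegral_eq_zero_of_differentiable_on_off_countable hr.le Set.countable_empty hc,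
    add_zero]
  · intro z hz
    exact (derivative F).differentiable.differentiableAt.div F.differentiable.differentiableAt
      (hF z (Metric.ball_subset_closedBall hz.1))
  · rw [circleIntegrable_sub_inv_iff]
    right
    simpa using (abs_pos.2 hr.ne').ne
  · exact (hc.mono hsub).circleIntegrable hr.le

/-- Lagrange inversion: a polynomial inverse, up to order `n`, of `X * F` has `n`-th coefficient
given by a contour integral of `(X * F)⁻ⁿ`. -/
lemma circleIntegral_inv_pow_X_mul (F : ℂ[X]) {r : ℝ} (hr : 0 < r)
    (hF : ∀ z ∈ Metric.closedBall (0 : ℂ) r, F.eval z ≠ 0) (A : ℕ → ℂ) {n : ℕ}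
    (hA : (X : ℂ[X]) ^ (n + 1) ∣ X - ∑ k ∈ range (n + 1), C (A k) * (X * F) ^ k) :
    (∮ z in C(0, r), ((X * F).eval z ^ n)⁻¹) = 2 * π * Complex.I * (n * A n) := by
  obtain ⟨Q, hQ⟩ := hA
  have hsub := Metric.sphere_subset_closedBall (x := (0 : ℂ)) (ε := r)
  have hS : ∀ z ∈ Metric.sphere (0 : ℂ) r, (X * F).eval z ≠ 0 := by
    intro z hz
    rw [eval_mul, eval_X]
    refine mul_ne_zero ?_ (hF z (hsub hz))
    rintro rfl
    simp at hz
    exact hr.ne hz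
  have hD : (1 : ℂ[X]) = ∑ k ∈ range (n + 1), C (k * A k) * ((X * F) ^ (k - 1) *
      derivative (X * F)) + X ^ n * (C ((n + 1 : ℕ) : ℂ) * Q + X * derivative Q) := by
    have h := congrArg derivative (sub_eq_iff_eq_add.1 hQ)
    rw [derivative_X, derivative_add, derivative_sum] at h
    rw [h, add_comm]
    congr 1
    · refine Finset.sum_congr rfl fun k _ => ?_
      rw [derivative_C_mul, derivative_pow, C_mul]
      ring
    · rw [derivative_mul, derivative_X_pow, Nat.add_sub_cancel]
      ring
  set P : ℂ[X] := C ((n + 1 : ℕ) : ℂ) * Q + X * derivative Q with hP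
  have hparts : ∀ z ∈ Metric.sphere (0 : ℂ) r, ((X * F).eval z ^ n)⁻¹ =
      (∑ k ∈ range (n + 1), (k * A k) * ((X * F).eval z ^ ((k : ℤ) - 1 - n) *
        (derivative (X * F)).eval z)) + P.eval z / F.eval z ^ n := by
    intro z hz
    have h := congrArg (fun p => (((X * F).eval z ^ n)⁻¹) * eval z p) hD
    simp only [eval_one, mul_one] at h
    rw [h, eval_add, mul_add, eval_finsetSum, Finset.mul_sum]
    congr 1
    · refine Finset.sum_congr rfl fun k _ => ?_
      rcases Nat.eq_zero_or_pos k with rfl | hk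
      · simp
      · rw [zpow_sub₀ (hS z hz), zpow_natCast, show (k : ℤ) - 1 = ((k - 1 : ℕ) : ℤ) by omega,
          zpow_natCast]
        simp only [eval_mul, eval_pow, eval_C]
        ring
    · have h1 := hS z hz
      have h2 := hF z (hsub hz)
      rw [eval_mul, eval_X] at h1
      simp only [eval_mul, eval_X, eval_pow, mul_pow]
      have : z ≠ 0 := left_ne_zero_of_mul h1
      field_simp
  have hc : ContinuousOn (fun z => P.eval z / F.eval z ^ n) (Metric.closedBall 0 r) :=
    P.continuous.continuousOn.div (F.continuous.pow n).continuousOn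
      fun z hz => pow_ne_zero _ (hF z hz)
  have hk : ∀ k ∈ range (n + 1), CircleIntegrable (fun z => ((k : ℂ) * A k) *
      ((X * F).eval z ^ ((k : ℤ) - 1 - n) * (derivative (X * F)).eval z)) 0 r := by
    intro k _
    refine ContinuousOn.circleIntegrable hr.le ?_
    refine continuousOn_const.mul (ContinuousOn.mul ?_ (derivative (X * F)).continuous.continuousOn)
    exact (X * F).continuous.continuousOn.zpow₀ _ fun z hz => Or.inl (hS z hz)
  rw [circleIntegral.integral_congr hr.le hparts, circleIntegral.integral_add
    (CircleIntegrable.fun_sum _ hk) ((hc.mono hsub).circleIntegrable hr.le),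
    Complex.circleIntegral_eq_zero_of_differentiable_on_off_countable hr.le Set.countable_empty hc,
    add_zero, circleIntegral.integral_fun_sum hk, Finset.sum_eq_single n]
  · rw [circleIntegral.integral_const_mul, mul_comm]
    congr 1
    rw [← circleIntegral_logDeriv_X_mul F hr hF]
    simp
  · intro k _ hkn
    rw [circleIntegral.integral_const_mul, circleIntegral_pow_mul_deriv_div_pow hr.le
      (fun z => (X * F).hasDerivAt z) hS (by omega), mul_zero]
  · intro h
    simp at h
  · intro z hz
    exact P.differentiable.differentiableAt.div (F.differentiable.differentiableAt.pow n)
      (pow_ne_zero _ (hF z (Metric.ball_subset_closedBall hz.1)))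

lemma abs_sin_nat_mul_le (k : ℕ) (t : ℝ) : |Real.sin (k * t)| ≤ k * |Real.sin t| := by
  induction k with
  | zero => simp
  | succ k ih =>
    have h : ((k + 1 : ℕ) : ℝ) * t = k * t + t := by push_cast; ring
    rw [h, Real.sin_add]
    refine (abs_add_le _ _).trans ?_
    rw [abs_mul, abs_mul]
    have h1 := mul_le_mul_of_nonneg_left (Real.abs_cos_le_one t) (abs_nonneg (Real.sin (k * t)))
    have h2 := mul_le_mul_of_nonneg_right (Real.abs_cos_le_one (k * t)) (abs_nonneg (Real.sin t))
    push_cast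
    linarith

lemma one_sub_cos_nat_mul_le (k : ℕ) (t : ℝ) :
    1 - Real.cos (k * t) ≤ (k : ℝ) ^ 2 * (1 - Real.cos t) := by
  have e : ∀ x : ℝ, 1 - Real.cos x = 2 * |Real.sin (x / 2)| ^ 2 := by
    intro x
    have := Real.cos_sq_add_sin_sq (x / 2)
    have h := Real.cos_two_mul (x / 2)
    rw [show 2 * (x / 2) = x by ring] at h
    rw [sq_abs]
    linarith
  rw [e, e, mul_div_assoc]
  have := pow_le_pow_left₀ (abs_nonneg _) (abs_sin_nat_mul_le k (t / 2)) 2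
  rw [mul_pow] at this
  linarith

/-- The absolute values of the terms of the power series of `J₁(2√ρ)/√ρ`. -/
noncomputable def besselTerm (ρ : ℝ) (j : ℕ) : ℝ :=
  ρ ^ j / ((Nat.factorial j : ℝ) * (Nat.factorial (j + 1) : ℝ))

lemma besselTerm_nonneg {ρ : ℝ} (h : 0 ≤ ρ) (j : ℕ) : 0 ≤ besselTerm ρ j := by
  rw [besselTerm]; positivity

lemma besselTerm_succ (ρ : ℝ) (j : ℕ) :
    besselTerm ρ (j + 1) = besselTerm ρ j * (ρ / ((j + 1) * (j + 2))) := by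
  have : (Nat.factorial j : ℝ) ≠ 0 := by positivity
  simp only [besselTerm, Nat.factorial_succ]
  push_cast
  field_simp
  ring

lemma antitone_besselTerm {ρ : ℝ} (h : 0 ≤ ρ) (h2 : ρ ≤ 2) : Antitone (besselTerm ρ) := by
  refine antitone_nat_of_succ_le fun j => ?_
  rw [besselTerm_succ]
  refine mul_le_of_le_one_right (besselTerm_nonneg h j) ?_
  rw [div_le_one (by positivity)]
  have : (0 : ℝ) ≤ j := by positivity
  nlinarith

lemma summable_besselTerm {ρ : ℝ} (h : 0 ≤ ρ) : Summable (besselTerm ρ) := by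
  refine Summable.of_nonneg_of_le (besselTerm_nonneg h) (fun j => ?_)
    (Real.summable_pow_div_factorial ρ)
  rw [besselTerm]
  gcongr
  have : (1 : ℝ) ≤ Nat.factorial (j + 1) := by exact_mod_cast Nat.factorial_pos _
  have h' : (0 : ℝ) ≤ Nat.factorial j := by positivity
  nlinarith

/-- The function `J₁(2√ρ)/√ρ`. -/
noncomputable def besselSum (ρ : ℝ) : ℝ := ∑' j, (-1) ^ j * besselTerm ρ j

lemma tendsto_besselSum {ρ : ℝ} (h : 0 ≤ ρ) :
    Filter.Tendsto (fun n => ∑ i ∈ range n, (-1) ^ i * besselTerm ρ i) Filter.atTop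
      (nhds (besselSum ρ)) :=
  (summable_besselTerm h).tendsto_alternating_series_tsum

lemma besselSum_le {ρ : ℝ} (h : 0 ≤ ρ) (h2 : ρ ≤ 2) (k : ℕ) :
    besselSum ρ ≤ ∑ i ∈ range (2 * k + 1), (-1) ^ i * besselTerm ρ i :=
  (antitone_besselTerm h h2).tendsto_le_alternating_series (tendsto_besselSum h) k

lemma besselSum_le_one {ρ : ℝ} (h : 0 ≤ ρ) (h2 : ρ ≤ 2) : besselSum ρ ≤ 1 := by
  simpa [besselTerm] using besselSum_le h h2 0

lemma besselSum_pos {ρ : ℝ} (h : 0 ≤ ρ) (h2 : ρ < 2) : 0 < besselSum ρ := by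
  have := (antitone_besselTerm h h2.le).alternating_series_le_tendsto (tendsto_besselSum h) 1
  simp [besselTerm, Finset.sum_range_succ] at this
  linarith

/-- The rate at which the modulus of `S` grows away from the positive real axis. -/
noncomputable def besselGap (ρ : ℝ) : ℝ := ρ / 2 - ρ ^ 2 / 3 - 5 * ρ ^ 4 / 891

lemma besselGap_eq (ρ : ℝ) : besselGap ρ = ρ * (1 / 2 - ρ / 3 - 5 * ρ ^ 3 / 891) := by
  rw [besselGap]; ring

lemma besselGap_factor_pos {ρ : ℝ} (h : 0 ≤ ρ) (h2 : ρ ≤ 1.4461) :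
    0 < 1 / 2 - ρ / 3 - 5 * ρ ^ 3 / 891 := by
  have : ρ ^ 3 ≤ 1.4461 ^ 3 := pow_le_pow_left₀ h h2 3
  norm_num at this h2
  linarith

lemma besselTerm_even_decay {ρ : ℝ} (h : 0 ≤ ρ) (h2 : ρ ≤ 2) (M : ℕ) :
    100 * (((2 * (M + 1) + 4 : ℕ) : ℝ) ^ 2 * besselTerm ρ (2 * (M + 1) + 4)) ≤
      ((2 * M + 4 : ℕ) : ℝ) ^ 2 * besselTerm ρ (2 * M + 4) := by
  have hM : (0 : ℝ) ≤ M := by positivity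
  rw [show 2 * (M + 1) + 4 = 2 * M + 4 + 1 + 1 by ring, besselTerm_succ, besselTerm_succ]
  push_cast
  have hb := besselTerm_nonneg h (2 * M + 4)
  have hρ : ρ ^ 2 ≤ 4 := by nlinarith
  have key : 100 * ((2 * (M : ℝ) + 4 + 1 + 1) ^ 2 * (ρ / ((2 * (M : ℝ) + 4 + 1) * (2 * M + 4 + 2)) *
      (ρ / ((2 * (M : ℝ) + 4 + 1 + 1) * (2 * M + 4 + 1 + 2))))) ≤ (2 * (M : ℝ) + 4) ^ 2 := by
    have e : 100 * ((2 * (M : ℝ) + 4 + 1 + 1) ^ 2 * (ρ / ((2 * (M : ℝ) + 4 + 1) * (2 * M + 4 + 2)) *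
      (ρ / ((2 * (M : ℝ) + 4 + 1 + 1) * (2 * M + 4 + 1 + 2))))) =
      100 * ρ ^ 2 / ((2 * (M : ℝ) + 5) * (2 * M + 7)) := by
      field_simp
      ring
    rw [e, div_le_iff₀ (by positivity)]
    have h1 : (16 : ℝ) ≤ (2 * (M : ℝ) + 4) ^ 2 := by nlinarith
    have h3 : (35 : ℝ) ≤ (2 * (M : ℝ) + 5) * (2 * M + 7) := by nlinarith
    nlinarith
  calc _ = 100 * ((2 * (M : ℝ) + 4 + 1 + 1) ^ 2 * (ρ / ((2 * (M : ℝ) + 4 + 1) * (2 * M + 4 + 2)) *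
      (ρ / ((2 * (M : ℝ) + 4 + 1 + 1) * (2 * M + 4 + 1 + 2))))) * besselTerm ρ (2 * M + 4) := by ring
    _ ≤ _ := mul_le_mul_of_nonneg_right key hb

lemma sum_besselTerm_mul_cos_aux {ρ : ℝ} (h : 0 ≤ ρ) (h2 : ρ ≤ 2) (t : ℝ) (M : ℕ) :
    (1 - Real.cos t) * (besselGap ρ +
      (((2 * M + 4 : ℕ) : ℝ) ^ 2 * besselTerm ρ (2 * M + 4)) / 99) ≤
    ∑ i ∈ range (2 * M + 4 + 1), (-1) ^ i * besselTerm ρ i * (Real.cos (i * t) - 1) := by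
  induction M with
  | zero =>
    have e2 := one_sub_cos_nat_mul_le 2 t
    have e3 := Real.cos_le_one (3 * t)
    have e4 := one_sub_cos_nat_mul_le 4 t
    have b2 := mul_le_mul_of_nonneg_left e2 (besselTerm_nonneg h 2)
    have b3 := mul_nonneg (sub_nonneg.2 e3) (besselTerm_nonneg h 3)
    have b4 := mul_le_mul_of_nonneg_left e4 (besselTerm_nonneg h 4)
    simp only [besselTerm, Nat.factorial] at b2 b3 b4
    simp only [besselTerm, besselGap, Finset.sum_range_succ, Nat.factorial]
    norm_num at b2 b3 b4 ⊢
    linarith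
  | succ M ih =>
    rw [show 2 * (M + 1) + 4 + 1 = 2 * M + 4 + 1 + 1 + 1 by ring, Finset.sum_range_succ,
      Finset.sum_range_succ]
    have hd := besselTerm_even_decay h h2 M
    have he := one_sub_cos_nat_mul_le (2 * M + 4 + 1 + 1) t
    have ho := Real.cos_le_one ((2 * M + 4 + 1 : ℕ) * t)
    have b1 := mul_le_mul_of_nonneg_left he (besselTerm_nonneg h (2 * M + 4 + 1 + 1))
    have b2 := mul_nonneg (sub_nonneg.2 ho) (besselTerm_nonneg h (2 * M + 4 + 1))
    have b3 := mul_le_mul_of_nonneg_left hd (sub_nonneg.2 (Real.cos_le_one t))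
    have s1 : (-1 : ℝ) ^ (2 * M + 4 + 1) = -1 := Odd.neg_one_pow ⟨M + 2, by ring⟩
    have s2 : (-1 : ℝ) ^ (2 * M + 4 + 1 + 1) = 1 := Even.neg_one_pow ⟨M + 3, by ring⟩
    rw [s1, s2]
    rw [show 2 * (M + 1) + 4 = 2 * M + 4 + 1 + 1 by ring] at b3 ⊢
    linarith

lemma besselSum_add_gap_le {ρ : ℝ} (h : 0 ≤ ρ) (h2 : ρ ≤ 2) (t : ℝ) (M : ℕ) :
    besselSum ρ + besselGap ρ * (1 - Real.cos t) ≤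
    ∑ i ∈ range (2 * M + 4 + 1), (-1) ^ i * besselTerm ρ i * Real.cos (i * t) := by
  have h1 := sum_besselTerm_mul_cos_aux h h2 t M
  have h3 := besselSum_le h h2 (M + 2)
  rw [show 2 * (M + 2) + 1 = 2 * M + 4 + 1 by ring] at h3
  simp only [mul_sub, mul_one, Finset.sum_sub_distrib] at h1
  have := mul_nonneg (sub_nonneg.2 (Real.cos_le_one t))
    (mul_nonneg (sq_nonneg ((2 * M + 4 : ℕ) : ℝ)) (besselTerm_nonneg h (2 * M + 4)))
  linarith

lemma besselSum_add_gap_le_norm {s : ℝ} (h : 0 ≤ s) (h2 : π ^ 2 * s ≤ 2) (t : ℝ) (M : ℕ) :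
    besselSum (π ^ 2 * s) + besselGap (π ^ 2 * s) * (1 - Real.cos t) ≤
    ‖((besselPoly (2 * M + 4)).map (algebraMap ℝ ℂ)).eval (s * Complex.exp (t * Complex.I))‖ := by
  refine (besselSum_add_gap_le (by positivity) h2 t M).trans
    (le_of_eq_of_le ?_ (Complex.re_le_norm _))
  simp only [besselPoly, Polynomial.map_sum, eval_finsetSum, Complex.re_sum]
  refine Finset.sum_congr rfl fun i _ => ?_
  rw [Polynomial.map_mul, map_C, Polynomial.map_pow, map_X, eval_mul, eval_C, eval_pow, eval_X,
    mul_pow, ← Complex.exp_nat_mul, ← Complex.ofReal_pow, ← mul_assoc, Complex.coe_algebraMap,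
    ← Complex.ofReal_mul, Complex.re_ofReal_mul, ← mul_assoc, ← Complex.ofReal_natCast,
    ← Complex.ofReal_mul, Complex.exp_ofReal_mul_I_re, besselTerm, besselCoeff, mul_pow, ← pow_mul]
  ring

lemma eval_besselPoly_ne_zero {r : ℝ} (h2 : π ^ 2 * r ≤ 1.4461) (M : ℕ) :
    ∀ z ∈ Metric.closedBall (0 : ℂ) r,
      ((besselPoly (2 * M + 4)).map (algebraMap ℝ ℂ)).eval z ≠ 0 := by
  intro z hz
  rw [mem_closedBall_zero_iff] at hz
  have h1 : π ^ 2 * ‖z‖ ≤ 1.4461 := (mul_le_mul_of_nonneg_left hz (sq_nonneg π)).trans h2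
  have h0 : 0 ≤ π ^ 2 * ‖z‖ := by positivity
  have h := besselSum_add_gap_le_norm (norm_nonneg z) (h1.trans (by norm_num)) z.arg M
  rw [Complex.norm_mul_exp_arg_mul_I] at h
  have h3 := besselSum_pos h0 (h1.trans_lt (by norm_num))
  have h4 := mul_nonneg (mul_nonneg h0 (besselGap_factor_pos h0 h1).le)
    (sub_nonneg.2 (Real.cos_le_one z.arg))
  rw [← besselGap_eq] at h4
  rw [← norm_pos_iff]
  linarith

lemma J0_term_eq (x : ℝ) (k : ℕ) : (-1 : ℝ) ^ k * (x / 2) ^ (2 * k) / ((Nat.factorial k : ℝ)) ^ 2 =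
    (-1) ^ k * (((x / 2) ^ 2) ^ k / (Nat.factorial k : ℝ) ^ 2) := by
  rw [pow_mul, mul_div_assoc]

lemma pow_div_factorial_sq_le {w : ℝ} (hw : 0 ≤ w) (k : ℕ) :
    w ^ k / (Nat.factorial k : ℝ) ^ 2 ≤ w ^ k / (Nat.factorial k : ℝ) := by
  have h : (1 : ℝ) ≤ Nat.factorial k := by exact_mod_cast Nat.factorial_pos _
  gcongr
  nlinarith

lemma summable_pow_div_factorial_sq {w : ℝ} (hw : 0 ≤ w) :
    Summable fun k : ℕ => w ^ k / (Nat.factorial k : ℝ) ^ 2 :=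
  Summable.of_nonneg_of_le (fun k => by positivity) (pow_div_factorial_sq_le hw)
    (Real.summable_pow_div_factorial w)

lemma continuousOn_J0 : ContinuousOn J0 (Set.Icc 0 2.405) := by
  unfold J0
  refine continuousOn_tsum (fun k => by fun_prop)
    (Real.summable_pow_div_factorial 4) fun k x hx => ?_
  rw [J0_term_eq, norm_mul, norm_pow, norm_neg, norm_one, one_pow, one_mul, Real.norm_of_nonneg
    (by positivity)]
  refine (pow_div_factorial_sq_le (sq_nonneg _) k).trans ?_
  gcongr
  have h1 := hx.1
  have h2 := hx.2
  norm_num at h2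
  nlinarith

lemma J0_zero : J0 0 = 1 := by
  rw [J0, tsum_eq_single 0]
  · simp
  · intro k hk
    simp [hk]

lemma J0_neg : J0 2.405 < 0 := by
  set w : ℝ := (2.405 / 2) ^ 2 with hw
  have hw0 : 0 ≤ w := sq_nonneg _
  set a : ℕ → ℝ := fun k => w ^ (k + 1) / (Nat.factorial (k + 1) : ℝ) ^ 2 with ha
  have hanti : Antitone a := by
    refine antitone_nat_of_succ_le fun k => ?_
    have e : a (k + 1) = a k * (w / (k + 2) ^ 2) := by
      have : (Nat.factorial k : ℝ) ≠ 0 := by positivity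
      simp only [ha, Nat.factorial_succ]
      push_cast
      field_simp
      ring
    rw [e]
    refine mul_le_of_le_one_right (by positivity) ?_
    rw [div_le_one (by positivity)]
    have : (0 : ℝ) ≤ k := by positivity
    rw [hw]
    norm_num
    nlinarith
  have hs : Summable a := (summable_nat_add_iff 1).2 (summable_pow_div_factorial_sq hw0)
  have h1 := hanti.alternating_series_le_tendsto hs.tendsto_alternating_series_tsum 3
  have h2 : J0 2.405 = 1 - ∑' k, (-1) ^ k * a k := by
    have hf : Summable fun k : ℕ => (-1 : ℝ) ^ k * (w ^ k / (Nat.factorial k : ℝ) ^ 2) :=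
      (summable_pow_div_factorial_sq hw0).alternating
    rw [J0]
    simp only [J0_term_eq, ← hw]
    rw [hf.tsum_eq_zero_add, sub_eq_add_neg, ← tsum_neg]
    congr 1
    · simp
    · refine tsum_congr fun k => ?_
      simp only [ha]
      ring
  rw [h2]
  simp only [ha, hw, Finset.sum_range_succ, Nat.factorial] at h1 ⊢
  norm_num at h1 ⊢
  linarith

lemma c0_nonneg : 0 ≤ c0 := Real.sInf_nonneg fun _ hx => hx.1.le

lemma c0_le : c0 ≤ 2.405 := by
  have hmem : (0 : ℝ) ∈ Set.Icc (J0 2.405) (J0 0) := ⟨J0_neg.le, by rw [J0_zero]; norm_num⟩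
  obtain ⟨x, hx, h⟩ := intermediate_value_Icc' (by norm_num) continuousOn_J0 hmem
  have hx0 : x ≠ 0 := by
    rintro rfl
    rw [J0_zero] at h
    exact one_ne_zero h
  have hb : BddBelow {x : ℝ | 0 < x ∧ J0 x = 0} := ⟨0, fun _ hy => hy.1.le⟩
  have hx' : x ∈ {x : ℝ | 0 < x ∧ J0 x = 0} := ⟨lt_of_le_of_ne hx.1 hx0.symm, h⟩
  rw [c0]
  exact (csInf_le hb hx').trans hx.2

lemma xc_eq : xc = c0 ^ 2 / (4 * π ^ 2) * besselSum (π ^ 2 * (c0 ^ 2 / (4 * π ^ 2))) := by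
  have e : π ^ 2 * (c0 ^ 2 / (4 * π ^ 2)) = (c0 / 2) ^ 2 := by
    field_simp
    ring
  have h : J1 c0 = c0 / 2 * besselSum ((c0 / 2) ^ 2) := by
    rw [J1, besselSum, ← tsum_mul_left]
    refine tsum_congr fun k => ?_
    rw [besselTerm, pow_succ, pow_mul]
    ring
  rw [e, xc, h]
  field_simp
  ring

lemma integral_inv_one_add_mul_sq_le {b : ℝ} (hb : 0 < b) :
    ∫ t in (-π)..π, (1 + b * t ^ 2)⁻¹ ≤ π / √b := by
  have hs : 0 < √b := Real.sqrt_pos.2 hb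
  have e : ∀ t : ℝ, (1 + b * t ^ 2)⁻¹ = (1 + (√b * t) ^ 2)⁻¹ := by
    intro t
    rw [mul_pow, Real.sq_sqrt hb.le]
  simp only [e]
  rw [intervalIntegral.integral_comp_mul_left (fun t => (1 + t ^ 2)⁻¹) hs.ne',
    integral_inv_one_add_sq, smul_eq_mul, ← div_eq_inv_mul]
  gcongr
  have h1 := Real.arctan_lt_pi_div_two (√b * π)
  have h2 := Real.neg_pi_div_two_lt_arctan (√b * -π)
  linarith

lemma integral_inv_one_add_cos_pow_le {c : ℝ} (hc : 0 < c) {n : ℕ} (hn : 1 ≤ n) :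
    ∫ t in (0:ℝ)..2 * π, ((1 + c * (1 - Real.cos t)) ^ n)⁻¹ ≤ π / √(n * (c * (2 / π ^ 2))) := by
  have hcont : Continuous fun t => ((1 + c * (1 - Real.cos t)) ^ n)⁻¹ := by
    refine Continuous.inv₀ (by fun_prop) fun t => ?_
    have := mul_nonneg hc.le (sub_nonneg.2 (Real.cos_le_one t))
    positivity
  have hper : Function.Periodic (fun t => ((1 + c * (1 - Real.cos t)) ^ n)⁻¹) (2 * π) := by
    intro t
    simp
  have h := hper.intervalIntegral_add_eq 0 (-π)
  rw [zero_add, show -π + 2 * π = π by ring] at h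
  have hn' : (0 : ℝ) < n := by exact_mod_cast hn
  have hb : 0 < n * (c * (2 / π ^ 2)) := by positivity
  rw [h]
  refine le_trans ?_ (integral_inv_one_add_mul_sq_le hb)
  refine intervalIntegral.integral_mono_on (by linarith [pi_pos])
    (hcont.intervalIntegrable _ _) (Continuous.intervalIntegrable ?_ _ _) fun t ht => ?_
  · refine Continuous.inv₀ (by fun_prop) fun t => ?_
    positivity
  · gcongr
    have h1 := Real.cos_le_one_sub_mul_cos_sq (abs_le.2 ht)
    have h2 : c * (2 / π ^ 2 * t ^ 2) ≤ c * (1 - Real.cos t) := by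
      gcongr
      linarith
    have h3 := one_add_mul_le_pow (a := c * (1 - Real.cos t))
      (by linarith [mul_nonneg hc.le (sub_nonneg.2 (Real.cos_le_one t))]) n
    nlinarith

lemma pow_mul_norm_integrand_le (F : ℂ[X]) {r f c t : ℝ} (hr : 0 < r) (hf0 : 0 < f)
    (hc : 0 < 1 + c * (1 - Real.cos t))
    (hF : f * (1 + c * (1 - Real.cos t)) ≤ ‖F.eval (circleMap 0 r t)‖) (n : ℕ) :
    (r * f) ^ n * ‖deriv (circleMap 0 r) t • ((X * F).eval (circleMap 0 r t) ^ n)⁻¹‖ ≤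
      r * ((1 + c * (1 - Real.cos t)) ^ n)⁻¹ := by
  have e : ‖deriv (circleMap 0 r) t • ((X * F).eval (circleMap 0 r t) ^ n)⁻¹‖ =
      r * ((r * ‖F.eval (circleMap 0 r t)‖) ^ n)⁻¹ := by
    rw [deriv_circleMap, norm_smul, norm_mul, Complex.norm_I, mul_one, norm_circleMap_zero,
      abs_of_pos hr, norm_inv, norm_pow, eval_mul, eval_X, norm_mul, norm_circleMap_zero,
      abs_of_pos hr]
  rw [e]
  generalize ‖F.eval (circleMap 0 r t)‖ = m at hF
  generalize 1 + c * (1 - Real.cos t) = d at hc hF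
  have h : ((r * m) ^ n)⁻¹ ≤ ((r * (f * d)) ^ n)⁻¹ := by gcongr
  calc (r * f) ^ n * (r * ((r * m) ^ n)⁻¹)
      ≤ (r * f) ^ n * (r * ((r * (f * d)) ^ n)⁻¹) := by gcongr
    _ = r * (d ^ n)⁻¹ := by
      rw [← mul_assoc r f d, mul_pow (r * f) d]
      field_simp

lemma continuous_circle_integrand (F : ℂ[X]) {r : ℝ}
    (hF : ∀ t, F.eval (circleMap 0 r t) ≠ 0) (n : ℕ) :
    Continuous fun t => deriv (circleMap 0 r) t • (F.eval (circleMap 0 r t) ^ n)⁻¹ := by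
  have h1 : Continuous (deriv (circleMap 0 r)) := by
    rw [show deriv (circleMap 0 r) = _ from funext (deriv_circleMap 0 r)]
    fun_prop
  have h2 : Continuous fun t => F.eval (circleMap 0 r t) ^ n :=
    (F.continuous.comp (continuous_circleMap 0 r)).pow n
  exact h1.smul (h2.inv₀ fun t => pow_ne_zero n (hF t))

lemma pow_mul_norm_circleIntegral_le (F : ℂ[X]) {r f c : ℝ} (hr : 0 < r) (hf0 : 0 < f) (hf1 : f ≤ 1)
    (hc0 : 0 < c) (hF : ∀ t : ℝ, f + c * (1 - Real.cos t) ≤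
      ‖F.eval (r * Complex.exp (t * Complex.I))‖) {n : ℕ} (hn : 1 ≤ n) :
    (r * f) ^ n * ‖∮ z in C(0, r), ((X * F).eval z ^ n)⁻¹‖ ≤
      r * (π / √(n * (c * (2 / π ^ 2)))) := by
  have hcos : ∀ t : ℝ, 0 ≤ c * (1 - Real.cos t) := fun t =>
    mul_nonneg hc0.le (sub_nonneg.2 (Real.cos_le_one t))
  have hpos : ∀ t : ℝ, 0 < 1 + c * (1 - Real.cos t) := fun t => by linarith [hcos t]
  have hF' : ∀ t : ℝ, f * (1 + c * (1 - Real.cos t)) ≤ ‖F.eval (circleMap 0 r t)‖ := fun t => by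
    rw [circleMap_zero]
    refine le_trans ?_ (hF t)
    rw [mul_add, mul_one]
    exact add_le_add_right (mul_le_of_le_one_left (hcos t) hf1) f
  have hne : ∀ t : ℝ, (X * F).eval (circleMap 0 r t) ≠ 0 := fun t => by
    rw [eval_mul, eval_X]
    exact mul_ne_zero (circleMap_ne_center hr.ne')
      (norm_pos_iff.1 ((mul_pos hf0 (hpos t)).trans_le (hF' t)))
  have hcont : Continuous fun t => r * ((1 + c * (1 - Real.cos t)) ^ n)⁻¹ :=
    continuous_const.mul (Continuous.inv₀ (by fun_prop) fun t => (pow_pos (hpos t) n).ne')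
  have hcont' : Continuous fun t => (r * f) ^ n *
      ‖deriv (circleMap 0 r) t • ((X * F).eval (circleMap 0 r t) ^ n)⁻¹‖ :=
    continuous_const.mul (continuous_circle_integrand (X * F) hne n).norm
  have h2π : (0 : ℝ) ≤ 2 * π := by positivity
  have hnorm : ‖∮ z in C(0, r), ((X * F).eval z ^ n)⁻¹‖ ≤ ∫ t in (0:ℝ)..2 * π,
      ‖deriv (circleMap 0 r) t • ((X * F).eval (circleMap 0 r t) ^ n)⁻¹‖ :=
    intervalIntegral.norm_integral_le_integral_norm h2π
  have hmono := intervalIntegral.integral_mono_on (μ := volume) h2π (hcont'.intervalIntegrable 0 (2 * π))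
    (hcont.intervalIntegrable 0 (2 * π)) fun t _ =>
      pow_mul_norm_integrand_le F hr hf0 (hpos t) (hF' t) n
  rw [intervalIntegral.integral_const_mul, intervalIntegral.integral_const_mul] at hmono
  exact (mul_le_mul_of_nonneg_left hnorm (pow_nonneg (mul_pos hr hf0).le n)).trans
    (hmono.trans (mul_le_mul_of_nonneg_left (integral_inv_one_add_cos_pow_le hc0 hn) hr.le))

lemma circleIntegral_eq_G {r : ℝ} (hr : 0 < r) (h2 : π ^ 2 * r ≤ 1.4461) {n : ℕ} (hn : 1 ≤ n) :
    (∮ z in C(0, r), ((X * (besselPoly (2 * n + 4)).map (algebraMap ℝ ℂ)).eval z ^ n)⁻¹) =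
      2 * π * Complex.I * (n * (G n 0 : ℂ)) := by
  refine circleIntegral_inv_pow_X_mul _ hr (eval_besselPoly_ne_zero h2 n) (fun k => (G k 0 : ℂ)) ?_
  have h := Polynomial.map_dvd (algebraMap ℝ ℂ)
    (X_pow_dvd_X_sub_sum_G hn (N := 2 * n + 4) (by omega))
  simpa [Polynomial.map_sum] using h

lemma pow_mul_G_zero_le {r : ℝ} (hr : 0 < r) (h2 : π ^ 2 * r ≤ 1.4461) {n : ℕ} (hn : 1 ≤ n) :
    (r * besselSum (π ^ 2 * r)) ^ n * G n 0 ≤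
      r / (2 * √(besselGap (π ^ 2 * r) * (2 / π ^ 2))) * (n : ℝ) ^ (-(3 : ℝ) / 2) := by
  have hn' : (0 : ℝ) < n := by exact_mod_cast hn
  have hρ : 0 ≤ π ^ 2 * r := by positivity
  have hc : 0 < besselGap (π ^ 2 * r) * (2 / π ^ 2) := by
    rw [besselGap_eq]
    have := besselGap_factor_pos hρ h2
    positivity
  have h := pow_mul_norm_circleIntegral_le _ hr (besselSum_pos hρ (h2.trans_lt (by norm_num)))
    (besselSum_le_one hρ (h2.trans (by norm_num))) (pos_of_mul_pos_left hc (by positivity))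
    (fun t => besselSum_add_gap_le_norm hr.le (h2.trans (by norm_num)) t n) hn
  have hs := Real.sqrt_pos.2 hc
  have hsn := Real.sqrt_pos.2 hn'
  rw [circleIntegral_eq_G hr h2 hn, norm_mul, norm_mul, norm_mul, norm_mul, Complex.norm_I,
    Complex.norm_natCast, Complex.norm_real, Complex.norm_real, Complex.norm_two,
    Real.norm_of_nonneg pi_pos.le, Real.norm_of_nonneg (G_nonneg n 0), Real.sqrt_mul hn'.le] at h
  have e : (n : ℝ) ^ (-(3 : ℝ) / 2) = 1 / (n * √n) := by
    rw [show -(3 : ℝ) / 2 = -(1 + 1 / 2) by norm_num, Real.rpow_neg hn'.le, Real.rpow_add hn',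
      Real.rpow_one, ← Real.sqrt_eq_rpow, one_div]
  rw [e, div_mul_div_comm, mul_one, le_div_iff₀ (by positivity)]
  rw [← mul_div_assoc, le_div_iff₀ (by positivity)] at h
  refine le_of_mul_le_mul_right ?_ pi_pos
  linarith

/-- Uniform-in-θ size bound (eq:uniftheta): there is `C > 0` with
`x_c^n G_n(θ) ≤ C n^{-3/2}` for all `n ≥ 1` and `θ ∈ [0,π]`. -/
theorem uniform_theta_bound :
    ∃ C : ℝ, 0 < C ∧ ∀ n : ℕ, 1 ≤ n → ∀ θ : ℝ, 0 ≤ θ → θ ≤ Real.pi →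
      xc ^ n * G n θ ≤ C * (n : ℝ) ^ (-(3 : ℝ) / 2) := by
  rcases c0_nonneg.eq_or_lt with h0 | h0
  · refine ⟨1, one_pos, fun n hn θ _ _ => ?_⟩
    rw [xc, ← h0, zero_mul, zero_div, zero_pow (by omega), zero_mul, one_mul]
    positivity
  · have hr : 0 < c0 ^ 2 / (4 * π ^ 2) := by positivity
    have h2 : π ^ 2 * (c0 ^ 2 / (4 * π ^ 2)) ≤ 1.4461 := by
      have e : π ^ 2 * (c0 ^ 2 / (4 * π ^ 2)) = c0 ^ 2 / 4 := by field_simp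
      have := pow_le_pow_left₀ h0.le c0_le 2
      rw [e]
      norm_num at this ⊢
      linarith
    have hgap : 0 < besselGap (π ^ 2 * (c0 ^ 2 / (4 * π ^ 2))) := by
      rw [besselGap_eq]
      have := besselGap_factor_pos (ρ := π ^ 2 * (c0 ^ 2 / (4 * π ^ 2))) (by positivity) h2
      positivity
    refine ⟨_, ?_, fun n hn θ hθ hθ' => le_trans ?_ (pow_mul_G_zero_le hr h2 hn)⟩
    · positivity
    · rw [← xc_eq]
      refine mul_le_mul_of_nonneg_left (G_le_G_zero n hθ hθ') (pow_nonneg ?_ n)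
      rw [xc_eq]
      exact mul_nonneg hr.le (besselSum_pos (by positivity) (h2.trans_lt (by norm_num))).le
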